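/- arXiv:1707.04754 — 10 statements merged into one kernel-verified Lean document; each statement's English description precedes it below -/
import Mathlib

section
/- Let n ≥ 1, let x_1,…,x_n be indeterminates, and work in the multivariate polynomial ring ℂ[x_1,…,x_n]. Let f(T) = ∏_{j=1}^n (T − x_j), a polynomial in T with coefficients in ℂ[x_1,…,x_n]. Fix k with 1 ≤ k ≤ n. Then the radical of the ideal generated by the elements f^{(1)}(x_k), …, f^{(n−1)}(x_k) (the first n−1 derivatives of f with respect to T, evaluated at T = x_k) equals the ideal generated by the elements x_k − x_1, x_k − x_2, …, x_k − x_n. -/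
open Polynomial MvPolynomial

/-- Over a `ℚ`-algebra, an ideal containing the `i`-th derivative of `p` at `r` contains the
`i`-th Taylor coefficient of `p` at `r`. -/
theorem taylor_coeff_mem_of_eval_iterate_derivative_mem {R : Type*} [CommRing R] [Algebra ℚ R]
    {I : Ideal R} {p : Polynomial R} {r : R} {i : ℕ}
    (h : Polynomial.eval r (Polynomial.derivative^[i] p) ∈ I) :
    (Polynomial.taylor r p).coeff i ∈ I := by
  have hfac : Polynomial.eval r (Polynomial.derivative^[i] p)
      = (i.factorial : ℚ) • (Polynomial.taylor r p).coeff i := by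
    rw [Polynomial.taylor_coeff, ← Polynomial.factorial_smul_hasseDeriv, Nat.cast_smul_eq_nsmul]
    simp
  have h0 : (i.factorial : ℚ) ≠ 0 := by exact_mod_cast i.factorial_ne_zero
  rw [← inv_smul_smul₀ h0 ((Polynomial.taylor r p).coeff i), ← hfac]
  exact I.smul_of_tower_mem _ h

/-- If a monic polynomial of degree `n` has a root `s` and its Taylor coefficients at `r` of
index below `n` lie in an ideal `I`, then `(s - r) ^ n` lies in `I`. -/
theorem sub_pow_natDegree_mem_of_taylor_coeff_mem {R : Type*} [CommRing R] {I : Ideal R}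
    {p : Polynomial R} (hp : p.Monic) {r s : R} (hs : p.eval s = 0)
    (h : ∀ i < p.natDegree, (Polynomial.taylor r p).coeff i ∈ I) :
    (s - r) ^ p.natDegree ∈ I := by
  have hsum := Polynomial.taylor_eval_sub r p s
  have hlead : (Polynomial.taylor r p).coeff p.natDegree = 1 := by
    rw [Polynomial.coeff_taylor_natDegree, hp.leadingCoeff]
  rw [hs, Polynomial.eval_eq_sum_range, Polynomial.natDegree_taylor, Finset.sum_range_succ,
    hlead, one_mul] at hsum
  rw [eq_neg_of_add_eq_zero_right hsum]
  exact I.neg_mem (I.sum_mem fun i hi => I.mul_mem_right _ (h i (Finset.mem_range.mp hi)))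

/-- The ideal generated by the `X k - X j` is the kernel of the map sending every variable
to `X k`. -/
theorem span_range_X_sub_X_eq_ker {σ R : Type*} [CommRing R] (k : σ) :
    Ideal.span (Set.range fun j : σ => (MvPolynomial.X k - MvPolynomial.X j : MvPolynomial σ R)) =
      RingHom.ker (MvPolynomial.aeval fun _ : σ => (MvPolynomial.X k : MvPolynomial σ R)) := by
  set J := Ideal.span (Set.range fun j : σ =>
    (MvPolynomial.X k - MvPolynomial.X j : MvPolynomial σ R)) with hJ
  apply le_antisymm
  · rw [hJ, Ideal.span_le]
    rintro _ ⟨j, rfl⟩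
    simp [RingHom.mem_ker]
  · intro p hp
    have hcomp : (Ideal.Quotient.mkₐ R J).comp
        (MvPolynomial.aeval fun _ : σ => (MvPolynomial.X k : MvPolynomial σ R)) =
        Ideal.Quotient.mkₐ R J := by
      ext j
      simp only [AlgHom.comp_apply, MvPolynomial.aeval_X, Ideal.Quotient.mkₐ_eq_mk]
      exact Ideal.Quotient.eq.mpr (Ideal.subset_span ⟨j, rfl⟩)
    have hmk := DFunLike.congr_fun hcomp p
    rw [AlgHom.comp_apply, RingHom.mem_ker.mp hp, map_zero] at hmk
    exact Ideal.Quotient.eq_zero_iff_mem.mp hmk.symm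

/-- For `f(T) = ∏ (T - xⱼ)` over `ℂ[x₁,…,xₙ]`, the radical of the ideal
generated by the first `n-1` derivatives of `f` evaluated at `x_k` equals the ideal
generated by the `x_k - x_j`. -/
theorem radical_span_derivatives_eq (n : ℕ) (hn : 1 ≤ n) (k : Fin n)
    (f : Polynomial (MvPolynomial (Fin n) ℂ))
    (hf : f = ∏ j : Fin n, (Polynomial.X - Polynomial.C (MvPolynomial.X j))) :
    (Ideal.span ((fun i : ℕ =>
        Polynomial.eval (MvPolynomial.X k) (Polynomial.derivative^[i] f)) ''
          {i : ℕ | 1 ≤ i ∧ i ≤ n - 1})).radical =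
      Ideal.span (Set.range fun j : Fin n =>
        (MvPolynomial.X k - MvPolynomial.X j : MvPolynomial (Fin n) ℂ)) := by
  have hroot (j : Fin n) : f.eval (MvPolynomial.X j) = 0 := by
    rw [hf, Polynomial.eval_prod]
    exact Finset.prod_eq_zero (Finset.mem_univ j) (by simp)
  have hmonic : f.Monic := hf ▸ Polynomial.monic_prod_X_sub_C _ _
  have hdeg : f.natDegree = n := by
    rw [hf, Polynomial.natDegree_finsetProd_X_sub_C_eq_card, Finset.card_univ, Fintype.card_fin]
  apply le_antisymm
  · rw [span_range_X_sub_X_eq_ker]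
    refine (RingHom.ker_isPrime _).isRadical.radical_le_iff.mpr (Ideal.span_le.mpr ?_)
    rintro _ ⟨i, ⟨-, hi⟩, rfl⟩
    set φ : MvPolynomial (Fin n) ℂ →ₐ[ℂ] MvPolynomial (Fin n) ℂ :=
      MvPolynomial.aeval fun _ => MvPolynomial.X k with hφ
    have hmap : f.map (φ : MvPolynomial (Fin n) ℂ →+* MvPolynomial (Fin n) ℂ) =
        (Polynomial.X - Polynomial.C (MvPolynomial.X k)) ^ n := by
      simp [hf, hφ, Polynomial.map_prod]
    change (φ : MvPolynomial (Fin n) ℂ →+* MvPolynomial (Fin n) ℂ) _ = 0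
    rw [← Polynomial.eval_map_apply, ← Polynomial.iterate_derivative_map, hmap,
      Polynomial.iterate_derivative_X_sub_pow]
    have : n - i ≠ 0 := by omega
    simp [hφ, this]
  · rw [Ideal.span_le]
    rintro _ ⟨j, rfl⟩
    beta_reduce
    rw [SetLike.mem_coe, ← neg_sub]
    refine (Ideal.neg_mem_iff _).mpr ⟨f.natDegree, ?_⟩
    refine sub_pow_natDegree_mem_of_taylor_coeff_mem hmonic (hroot j) fun i hi => ?_
    apply taylor_coeff_mem_of_eval_iterate_derivative_mem
    rcases Nat.eq_zero_or_pos i with rfl | hpos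
    · simp [hroot k]
    · exact Ideal.subset_span ⟨i, ⟨hpos, by omega⟩, rfl⟩
end

section
/- Let n ≥ 1, let x_1,…,x_n be indeterminates, and let f(T) = ∏_{j=1}^n (T − x_j), a polynomial in T with coefficients in ℂ[x_1,…,x_n]. Fix k and j with 1 ≤ k, j ≤ n. Then (x_j − x_k)^n belongs to the ideal of ℂ[x_1,…,x_n] generated by f^{(1)}(x_k), …, f^{(n−1)}(x_k). -/
open Polynomial MvPolynomial

theorem Polynomial.eval_hasseDeriv_mem_of_eval_iterate_derivative_mem {R : Type*} [CommRing R]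
    [Algebra ℚ R] {I : Ideal R} {f : Polynomial R} {a : R} {i : ℕ}
    (h : Polynomial.eval a (Polynomial.derivative^[i] f) ∈ I) :
    Polynomial.eval a (Polynomial.hasseDeriv i f) ∈ I := by
  rw [← Polynomial.factorial_smul_hasseDeriv, LinearMap.smul_apply, Polynomial.eval_smul,
    nsmul_eq_mul] at h
  have hu : IsUnit ((i.factorial : ℕ) : R) := by
    have := (IsUnit.mk0 ((i.factorial : ℕ) : ℚ)
      (Nat.cast_ne_zero.mpr i.factorial_ne_zero)).map (algebraMap ℚ R)
    rwa [map_natCast] at this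
  exact (Ideal.unit_mul_mem_iff_mem I hu).mp h

/-- If `a` and `b` are roots of a monic polynomial `f` of degree `n`, then `(b - a) ^ n` lies in
every ideal containing the intermediate derivatives of `f` at `a`. -/
theorem Polynomial.Monic.sub_pow_natDegree_mem {R : Type*} [CommRing R] [Algebra ℚ R]
    {I : Ideal R} {f : Polynomial R} (hf : f.Monic) {a b : R}
    (ha : f.IsRoot a) (hb : f.IsRoot b)
    (hI : ∀ i, 1 ≤ i → i < f.natDegree →
      Polynomial.eval a (Polynomial.derivative^[i] f) ∈ I) :
    (b - a) ^ f.natDegree ∈ I := by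
  have htaylor : Polynomial.eval (b - a) (Polynomial.taylor a f) = 0 := by
    rw [Polynomial.taylor_eval, sub_add_cancel]
    exact hb
  rw [Polynomial.eval_eq_sum_range, Polynomial.natDegree_taylor, Finset.sum_range_succ,
    Polynomial.coeff_taylor_natDegree, hf.leadingCoeff, one_mul] at htaylor
  rw [eq_neg_of_add_eq_zero_right htaylor]
  refine I.neg_mem (I.sum_mem fun i hi => I.mul_mem_right _ ?_)
  rcases Nat.eq_zero_or_pos i with rfl | hpos
  · rw [Polynomial.taylor_coeff_zero, ha.eq_zero]
    exact I.zero_mem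
  · rw [Polynomial.taylor_coeff]
    exact Polynomial.eval_hasseDeriv_mem_of_eval_iterate_derivative_mem
      (hI i hpos (Finset.mem_range.mp hi))

/-- For `f(T) = ∏ (T - xⱼ)` over `ℂ[x₁,…,xₙ]`, the element `(x_j - x_k)^n`
belongs to the ideal generated by the first `n-1` derivatives of `f` evaluated at `x_k`. -/
theorem pow_sub_mem_span_derivatives (n : ℕ) (hn : 1 ≤ n) (k j : Fin n)
    (f : Polynomial (MvPolynomial (Fin n) ℂ))
    (hf : f = ∏ l : Fin n, (Polynomial.X - Polynomial.C (MvPolynomial.X l))) :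
    (MvPolynomial.X j - MvPolynomial.X k : MvPolynomial (Fin n) ℂ) ^ n ∈
      Ideal.span ((fun i : ℕ =>
        Polynomial.eval (MvPolynomial.X k) (Polynomial.derivative^[i] f)) ''
          {i : ℕ | 1 ≤ i ∧ i ≤ n - 1}) := by
  have hmonic : f.Monic := hf ▸ Polynomial.monic_prod_X_sub_C _ _
  have hdeg : f.natDegree = n := by
    rw [hf, Polynomial.natDegree_finsetProd_X_sub_C_eq_card, Finset.card_univ, Fintype.card_fin]
  have hroot (l : Fin n) : f.IsRoot (MvPolynomial.X l) := by
    rw [hf, Polynomial.IsRoot.def, Polynomial.eval_prod]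
    exact Finset.prod_eq_zero (Finset.mem_univ l) (by simp)
  have hmem := hmonic.sub_pow_natDegree_mem (hroot k) (hroot j)
    (I := Ideal.span ((fun i : ℕ =>
      Polynomial.eval (MvPolynomial.X k) (Polynomial.derivative^[i] f)) ''
        {i : ℕ | 1 ≤ i ∧ i ≤ n - 1}))
    fun i hi hin => Ideal.subset_span ⟨i, ⟨hi, by omega⟩, rfl⟩
  rwa [hdeg] at hmem
end

section
/- Suppose that for every n ≥ 1 and every choice of indices i_1,…,i_{n−1} ∈ {1,…,n} there exists a bound N such that for every prime p > N the following holds: the number of tuples (a_1,…,a_n) ∈ 𝔽_p^n such that, setting f(X) = ∏_{l=1}^n (X − a_l) ∈ 𝔽_p[X], one has H_j(f)(a_{i_j}) = 0 for every j = 1,…,n−1, is exactly p. Then for every n ≥ 1, every Casas-Alvero tuple in ℂ^n has all entries equal. -/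
open Polynomial

/-- A tuple `(x₁,…,xₙ)` over a commutative ring is a *Casas-Alvero tuple* if, with
`f(X) = ∏ (X - xⱼ)`, for every `i = 1,…,n-1` some root `x_k` satisfies `H_i(f)(x_k) = 0`,
where `H_i` is the `i`-th Hasse derivative. -/
def IsCasasAlvero {R : Type*} [CommRing R] {n : ℕ} (x : Fin n → R) : Prop :=
  ∀ i : ℕ, 1 ≤ i → i ≤ n - 1 → ∃ k : Fin n,
    Polynomial.eval (x k)
      (Polynomial.hasseDeriv i (∏ j : Fin n, (Polynomial.X - Polynomial.C (x j)))) = 0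

/-- A nonconstant integer polynomial has a root modulo `p` for arbitrarily large primes `p`. -/
theorem exists_large_prime_root (g : ℤ[X]) (hg : 0 < g.natDegree) (N : ℕ) :
    ∃ p : ℕ, N < p ∧ p.Prime ∧ ∃ a : ZMod p, g.eval₂ (Int.castRingHom (ZMod p)) a = 0 := by
  set c := g.eval 0 with hc
  by_cases hc0 : c = 0
  · obtain ⟨p, hp, hpp⟩ := Nat.exists_infinite_primes (N + 1)
    refine ⟨p, hp, hpp, 0, ?_⟩
    have := eval₂_at_apply (p := g) (Int.castRingHom (ZMod p)) 0
    rw [← hc, hc0] at this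
    simpa using this
  · have hM : c * (N.factorial : ℤ) ≠ 0 :=
      mul_ne_zero hc0 (by exact_mod_cast N.factorial_ne_zero)
    set M := c * (N.factorial : ℤ) with hMdef
    set h := g.comp (C M * X) with hh
    have hdeg : h.natDegree ≠ 0 := by
      rw [hh, natDegree_comp, natDegree_C_mul_X _ hM]
      omega
    have hne : ∀ b : ℤ, h - C b ≠ 0 := fun b hb => hdeg (by
      rw [sub_eq_zero.mp hb, natDegree_C])
    obtain ⟨t, ht⟩ : ∃ t : ℤ, ((h - C c) * (h - C (-c))).eval t ≠ 0 := by
      by_contra! H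
      exact mul_ne_zero (hne c) (hne (-c)) (Polynomial.funext (by simpa using H))
    obtain ⟨k, hk⟩ : M ∣ g.eval (M * t) - c := by
      have := sub_dvd_eval_sub (M * t) 0 g
      rw [sub_zero] at this
      exact (dvd_mul_right M t).trans this
    have hval : g.eval (M * t) = c * (1 + N.factorial * k) := by
      rw [hMdef] at hk ⊢
      linear_combination hk
    have hu : (1 + N.factorial * k : ℤ).natAbs ≠ 1 := by
      intro h1
      apply ht
      have hht : h.eval t = g.eval (M * t) := by simp [hh]
      simp only [eval_mul, eval_sub, eval_C, hht, hval]
      rcases Int.natAbs_eq_iff.mp h1 with h2 | h2 <;> rw [h2] <;> push_cast <;> ring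
    have hq := Nat.minFac_prime hu
    set q := (1 + N.factorial * k : ℤ).natAbs.minFac with hqdef
    have hdvd : (q : ℤ) ∣ 1 + N.factorial * k :=
      Int.natCast_dvd.mpr (Nat.minFac_dvd _)
    refine ⟨q, ?_, hq, ((M * t : ℤ) : ZMod q), ?_⟩
    · by_contra! hle
      have h1 : (q : ℤ) ∣ N.factorial :=
        Int.natCast_dvd_natCast.mpr (hq.dvd_factorial.mpr hle)
      have h2 : (q : ℤ) ∣ 1 := (dvd_add_left (h1.mul_right k)).mp hdvd
      exact hq.one_lt.ne' (Nat.dvd_one.mp (by exact_mod_cast h2))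
    · have := eval₂_at_apply (p := g) (Int.castRingHom (ZMod q)) (M * t)
      rw [eq_intCast, eq_intCast] at this
      rw [this, ZMod.intCast_zmod_eq_zero_iff_dvd, hval]
      exact hdvd.mul_left c

/-- A ring homomorphism from a subring of a field to another field extends to any ring generated
by fractions whose denominators are not killed. -/
theorem nonempty_adjoin_ringHom_of_fractions {R K F : Type*} [CommRing R] [Field K] [Field F]
    (j : R →+* K) (hj : Function.Injective j) (φ : R →+* F) (T : Set K)
    (hT : ∀ t ∈ T, ∃ r s : R, φ s ≠ 0 ∧ t * j s = j r) :
    Nonempty (Algebra.adjoin ℤ T →+* F) := by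
  let M : Submonoid R := (nonZeroDivisors F).comap φ
  have hM : ∀ s : M, φ s ≠ 0 := fun s => nonZeroDivisors.ne_zero s.2
  have hφM : ∀ s : M, IsUnit (φ s) := fun s => isUnit_iff_ne_zero.mpr (hM s)
  have hjM : ∀ s : M, IsUnit (j s) := fun s => isUnit_iff_ne_zero.mpr fun h => hM s (by
    rw [(map_eq_zero_iff j hj).mp h, map_zero])
  let L := Localization M
  let J : L →+* K := IsLocalization.lift hjM
  let Φ : L →+* F := IsLocalization.lift hφM
  have hJ : Function.Injective J := by
    refine (IsLocalization.lift_injective_iff (S := L) hjM).mpr fun x y =>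
      ⟨fun h => ?_, fun h => ?_⟩
    · obtain ⟨c, hc⟩ := (IsLocalization.eq_iff_exists M L).mp h
      apply (hjM c).mul_left_cancel
      rw [← map_mul, ← map_mul, hc]
    · rw [hj h]
  let e : L ≃+* J.range := RingEquiv.ofBijective J.rangeRestrict
    ⟨fun x y h => hJ (congrArg Subtype.val h), J.rangeRestrict_surjective⟩
  have hle : ∀ x ∈ Algebra.adjoin ℤ T, x ∈ J.range := by
    intro x hx
    refine (Algebra.adjoin_le (S := subalgebraOfSubring J.range) ?_) hx
    intro t ht
    obtain ⟨r, s, hs, hts⟩ := hT t ht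
    refine ⟨IsLocalization.mk' L r (⟨s, mem_nonZeroDivisors_of_ne_zero hs⟩ : M), ?_⟩
    change IsLocalization.lift hjM _ = t
    rw [IsLocalization.lift_mk'_spec, mul_comm, ← hts, mul_comm]
  exact ⟨(Φ.comp e.symm.toRingHom).comp
    ((Algebra.adjoin ℤ T).val.toRingHom.codRestrict J.range fun x => hle x x.2)⟩

/-- A subring of a number field generated by finitely many elements has a homomorphism to `𝔽_p`
for arbitrarily large primes `p`. -/
theorem NumberField.exists_adjoin_ringHom_zmod {K : Type*} [Field K] [NumberField K]
    (T : Set K) (hT : T.Finite) (N : ℕ) :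
    ∃ p : ℕ, N < p ∧ p.Prime ∧ Nonempty (Algebra.adjoin ℤ T →+* ZMod p) := by
  obtain ⟨θ₀, hθ₀⟩ := Field.exists_primitive_element ℚ K
  have : Algebra.IsAlgebraic ℤ K :=
    (IsFractionRing.comap_isAlgebraic_iff (K := ℚ)).mpr inferInstance
  obtain ⟨m, hm, hθ⟩ :=
    (Algebra.IsAlgebraic.isAlgebraic (R := ℤ) θ₀).exists_integral_multiple
  set θ := m • θ₀ with hθdef
  have key : ∀ t : K, ∃ b : ℤ, b ≠ 0 ∧ ∃ q : ℤ[X], b * t = aeval θ q := by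
    intro t
    have ht : t ∈ Algebra.adjoin ℚ {θ₀} := by
      rw [← IntermediateField.adjoin_simple_toSubalgebra_of_isAlgebraic
        (Algebra.IsAlgebraic.isAlgebraic θ₀), hθ₀]
      trivial
    have hmK : (m : K) ≠ 0 := by exact_mod_cast hm
    rw [Algebra.adjoin_singleton_eq_range_aeval] at ht
    obtain ⟨r, rfl⟩ := ht
    obtain ⟨b, hb0, hb⟩ := IsLocalization.integerNormalization_spec (nonZeroDivisors ℤ)
      (r.comp (C (m : ℚ)⁻¹ * X))
    refine ⟨b, nonZeroDivisors.ne_zero hb0, IsLocalization.integerNormalization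
      (nonZeroDivisors ℤ) (r.comp (C (m : ℚ)⁻¹ * X)), ?_⟩
    have h := congrArg (aeval θ) hb
    rw [aeval_map_algebraMap] at h
    rw [h]
    have hθ' : (m : K)⁻¹ * θ = θ₀ := by
      rw [hθdef, zsmul_eq_mul, inv_mul_cancel_left₀ hmK]
    simp [aeval_comp, hθ']
  choose b hb q hq using key
  let g := minpoly ℤ θ
  obtain ⟨B, hB⟩ := (hT.image fun t => (b t).natAbs).bddAbove
  obtain ⟨p, hp, hpp, a, ha⟩ := exists_large_prime_root g (minpoly.natDegree_pos hθ)
    (max N B)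
  have : Fact p.Prime := ⟨hpp⟩
  refine ⟨p, (le_max_left _ _).trans_lt hp, hpp, ?_⟩
  refine nonempty_adjoin_ringHom_of_fractions
    ((Algebra.adjoin ℤ {θ}).val.toRingHom.comp (AdjoinRoot.Minpoly.toAdjoin ℤ θ).toRingHom)
    (Subtype.val_injective.comp (minpoly.ToAdjoin.injective hθ))
    (AdjoinRoot.lift (Int.castRingHom (ZMod p)) a ha) T fun t ht =>
      ⟨AdjoinRoot.mk g (q t), (b t : AdjoinRoot g), ?_, ?_⟩
  · rw [map_intCast, Ne, ZMod.intCast_zmod_eq_zero_iff_dvd, Int.natCast_dvd]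
    intro h
    have h1 := Nat.le_of_dvd (Int.natAbs_pos.mpr (hb t)) h
    have h2 : (b t).natAbs ≤ B := hB ⟨t, ht, rfl⟩
    have := le_max_right N B
    omega
  · have h : ((Algebra.adjoin ℤ {θ}).val.comp (AdjoinRoot.Minpoly.toAdjoin ℤ θ)).comp
        (AdjoinRoot.mkₐ g) = aeval θ := by
      ext
      simp [g]
    rw [map_intCast, mul_comm, hq]
    exact (DFunLike.congr_fun h (q t)).symm

/-- A nontrivial `ℚ`-algebra of finite type has a homomorphism to a number field. -/
theorem exists_ringHom_numberField.{u} (A : Type u) [CommRing A] [Nontrivial A] [Algebra ℚ A]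
    [Algebra.FiniteType ℚ A] :
    ∃ (K : Type u) (_ : Field K) (_ : NumberField K), Nonempty (A →+* K) := by
  obtain ⟨m, hm⟩ := Ideal.exists_maximal A
  let : Field (A ⧸ m) := Ideal.Quotient.field m
  have : Algebra.FiniteType ℚ (A ⧸ m) :=
    .of_surjective (Ideal.Quotient.mkₐ ℚ m) (Ideal.Quotient.mkₐ_surjective ℚ m)
  have hfin : Module.Finite ℚ (A ⧸ m) := finite_of_finite_type_of_isJacobsonRing ℚ (A ⧸ m)
  have : CharZero (A ⧸ m) := algebraRat.charZero _
  have hK : NumberField (A ⧸ m) := by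
    refine @NumberField.mk _ _ inferInstance ?_
    convert hfin
    exact Subsingleton.elim _ _
  exact ⟨A ⧸ m, inferInstance, hK, ⟨Ideal.Quotient.mk m⟩⟩

/-- A subring of a field of characteristic zero generated by finitely many elements has a
homomorphism to `𝔽_p` for arbitrarily large primes `p`. -/
theorem exists_adjoin_ringHom_zmod {E : Type*} [Field E] [CharZero E] (S : Set E)
    (hS : S.Finite) (N : ℕ) :
    ∃ p : ℕ, N < p ∧ p.Prime ∧ Nonempty (Algebra.adjoin ℤ S →+* ZMod p) := by
  let A := Algebra.adjoin ℚ S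
  have : Algebra.FiniteType ℚ A := .adjoin_of_finite hS
  obtain ⟨K, _, _, ⟨φ⟩⟩ := exists_ringHom_numberField A
  have hle : Algebra.adjoin ℤ S ≤ A.restrictScalars ℤ :=
    Algebra.adjoin_le Algebra.subset_adjoin
  let ψ : Algebra.adjoin ℤ S →ₐ[ℤ] K :=
    φ.toIntAlgHom.comp (Subalgebra.inclusion hle)
  obtain ⟨p, hp, hpp, ⟨f⟩⟩ := NumberField.exists_adjoin_ringHom_zmod
    (ψ '' (Subtype.val ⁻¹' S)) ((hS.preimage Subtype.val_injective.injOn).image _) N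
  refine ⟨p, hp, hpp, ⟨f.comp (ψ.codRestrict _ fun x => ?_).toRingHom⟩⟩
  rw [← AlgHom.map_adjoin, Algebra.adjoin_adjoin_coe_preimage]
  exact ⟨x, trivial, rfl⟩

/-- Ring homomorphisms commute with evaluating Hasse derivatives of split polynomials. -/
theorem eval_hasseDeriv_prod_map {R S ι : Type*} [CommRing R] [CommRing S] [Fintype ι]
    (f : R →+* S) (a : ι → R) (b : R) (k : ℕ) :
    eval (f b) (hasseDeriv k (∏ l, (X - C (f (a l))))) =
      f (eval b (hasseDeriv k (∏ l, (X - C (a l))))) := by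
  have h : (∏ l, (X - C (f (a l))) : S[X]) = (∏ l, (X - C (a l))).map f := by
    simp [Polynomial.map_prod]
  rw [h, ← taylor_coeff, ← taylor_coeff, ← coeff_map, taylor_apply, taylor_apply, map_comp]
  simp

/-- All Hasse derivatives of `(X - a) ^ n` but the `n`-th vanish at `a`. -/
theorem eval_hasseDeriv_X_sub_C_pow {R : Type*} [CommRing R] (a : R) {n k : ℕ} (hk : k ≠ n) :
    eval a (hasseDeriv k ((X - C a) ^ n)) = 0 := by
  rw [← taylor_coeff, taylor_pow]
  simp [coeff_X_pow, hk]

/-- If for every `n ≥ 1` and every branch `i₁,…,i_{n-1}` there is a bound `N`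
such that for all primes `p > N` the branch has exactly `p` solutions over `𝔽_p`, then every
Casas-Alvero tuple in `ℂⁿ` has all entries equal. -/
theorem casasAlvero_of_branch_count
    (H : ∀ n : ℕ, 1 ≤ n → ∀ idx : Fin (n - 1) → Fin n, ∃ N : ℕ, ∀ p : ℕ, N < p → p.Prime →
      Nat.card {a : Fin n → ZMod p // ∀ j : Fin (n - 1),
        Polynomial.eval (a (idx j))
          (Polynomial.hasseDeriv (j.val + 1)
            (∏ l : Fin n, (Polynomial.X - Polynomial.C (a l)))) = 0} = p) :
    ∀ n : ℕ, 1 ≤ n → ∀ x : Fin n → ℂ, IsCasasAlvero x → ∀ i j : Fin n, x i = x j := by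
  intro n hn x hx i j
  by_contra hij
  have hx' : ∀ k : Fin (n - 1), ∃ l : Fin n,
      eval (x l) (hasseDeriv (k.val + 1) (∏ j : Fin n, (X - C (x j)))) = 0 :=
    fun k => hx (k.val + 1) (by omega) (by omega)
  choose idx hidx using hx'
  obtain ⟨N, hN⟩ := H n hn idx
  let S : Set ℂ := insert (x i - x j)⁻¹ (Set.range x)
  obtain ⟨p, hp, hpp, ⟨f⟩⟩ := exists_adjoin_ringHom_zmod S ((Set.finite_range x).insert _) N
  have : Fact p.Prime := ⟨hpp⟩
  let y : Fin n → Algebra.adjoin ℤ S := fun l =>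
    ⟨x l, Algebra.subset_adjoin (Set.mem_insert_of_mem _ ⟨l, rfl⟩)⟩
  let w : Algebra.adjoin ℤ S := ⟨(x i - x j)⁻¹, Algebra.subset_adjoin (Set.mem_insert _ _)⟩
  have hw : (y i - y j) * w = 1 := Subtype.ext (mul_inv_cancel₀ (sub_ne_zero.mpr hij))
  have hy : ∀ k : Fin (n - 1),
      eval (y (idx k)) (hasseDeriv (k.val + 1) (∏ l : Fin n, (X - C (y l)))) = 0 := by
    intro k
    apply Subtype.val_injective
    refine (eval_hasseDeriv_prod_map (Algebra.adjoin ℤ S).subtype y (y (idx k)) _).symm.trans ?_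
    exact hidx k
  let const : ZMod p → {a : Fin n → ZMod p // ∀ j : Fin (n - 1),
        eval (a (idx j)) (hasseDeriv (j.val + 1) (∏ l : Fin n, (X - C (a l)))) = 0} :=
    fun c => ⟨fun _ => c, fun k => by
      simpa using eval_hasseDeriv_X_sub_C_pow c (n := n) (k := k.val + 1) (by omega)⟩
  have hconst : Function.Injective const := fun c d h => congrFun (congrArg Subtype.val h) i
  obtain ⟨c, hc⟩ := (hconst.bijective_of_nat_card_le
    (by rw [hN p hp hpp, Nat.card_zmod])).2
    ⟨fun l => f (y l), fun k => by rw [eval_hasseDeriv_prod_map, hy, map_zero]⟩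
  have hcl : ∀ l, c = f (y l) := fun l => congrFun (congrArg Subtype.val hc) l
  have h1 := congrArg f hw
  rw [map_mul, map_sub, ← hcl i, ← hcl j, sub_self, zero_mul, map_one] at h1
  exact zero_ne_one h1
end

section
/- Fix n ≥ 1 and suppose that every Casas-Alvero tuple in ℂ^n has all entries equal. Then there exists a bound N such that for every prime p > N, the number of tuples (a_1,…,a_n) ∈ 𝔽_p^n that are Casas-Alvero tuples over 𝔽_p (i.e., setting f(X) = ∏_{l=1}^n (X − a_l), for every i = 1,…,n−1 there exists k with H_i(f)(a_k) = 0) is exactly p. -/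
open Polynomial

theorem Polynomial.map_hasseDeriv {R S : Type*} [CommRing R] [CommRing S] (φ : R →+* S)
    (i : ℕ) (f : R[X]) : (hasseDeriv i f).map φ = hasseDeriv i (f.map φ) := by
  ext m
  simp [hasseDeriv_coeff]

theorem map_eval_hasseDeriv_prod_X_sub_C {R S : Type*} [CommRing R] [CommRing S] (φ : R →+* S)
    {n : ℕ} (x : Fin n → R) (i : ℕ) (k : Fin n) :
    φ ((hasseDeriv i (∏ j, (X - C (x j)))).eval (x k)) =
      (hasseDeriv i (∏ j, (X - C (φ (x j))))).eval (φ (x k)) := by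
  rw [← eval_map_apply, Polynomial.map_hasseDeriv]
  simp [Polynomial.map_prod]

theorem isCasasAlvero_iff_prod_eq_zero {R : Type*} [CommRing R] [IsDomain R] {n : ℕ}
    (x : Fin n → R) :
    IsCasasAlvero x ↔ ∀ i : ℕ, 1 ≤ i → i ≤ n - 1 →
      ∏ k, (hasseDeriv i (∏ j, (X - C (x j)))).eval (x k) = 0 := by
  simp [IsCasasAlvero, Finset.prod_eq_zero_iff]

theorem isCasasAlvero_const {R : Type*} [CommRing R] (n : ℕ) (a : R) :
    IsCasasAlvero (fun _ : Fin n => a) := by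
  intro i hi hin
  refine ⟨⟨0, by omega⟩, ?_⟩
  rw [← taylor_coeff]
  simp only [Finset.prod_const, Finset.card_univ, Fintype.card_fin, taylor_pow, map_sub, taylor_X,
    taylor_C, add_sub_cancel_right, coeff_X_pow]
  rw [if_neg (by omega)]

theorem IsCasasAlvero.map {R S : Type*} [CommRing R] [CommRing S] (φ : R →+* S) {n : ℕ}
    {x : Fin n → R} (hx : IsCasasAlvero x) : IsCasasAlvero (fun k => φ (x k)) := by
  intro i hi hin
  obtain ⟨k, hk⟩ := hx i hi hin
  exact ⟨k, by rw [← map_eval_hasseDeriv_prod_X_sub_C, hk, map_zero]⟩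

theorem IsCasasAlvero.of_map_injective {R S : Type*} [CommRing R] [CommRing S] (φ : R →+* S)
    (hφ : Function.Injective φ) {n : ℕ} {x : Fin n → R}
    (hx : IsCasasAlvero (fun k => φ (x k))) : IsCasasAlvero x := by
  intro i hi hin
  obtain ⟨k, hk⟩ := hx i hi hin
  exact ⟨k, hφ (by rw [map_eval_hasseDeriv_prod_X_sub_C, hk, map_zero])⟩

/-- A nontrivial finitely generated `ℚ`-algebra has a complex point. -/
theorem nonempty_algHom_complex_of_finiteType (A : Type*) [CommRing A] [Nontrivial A]
    [Algebra ℚ A] [Algebra.FiniteType ℚ A] : Nonempty (A →ₐ[ℚ] ℂ) := by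
  obtain ⟨m, hm⟩ := Ideal.exists_maximal A
  let := Ideal.Quotient.field m
  have := finite_of_finite_type_of_isJacobsonRing ℚ (A ⧸ m)
  exact ⟨(IsAlgClosed.lift (M := ℂ) (R := ℚ) (S := A ⧸ m)).comp (Ideal.Quotient.mkₐ ℚ m)⟩

theorem IsCasasAlvero.apply_eq_of_charZero {n : ℕ}
    (H : ∀ x : Fin n → ℂ, IsCasasAlvero x → ∀ i j : Fin n, x i = x j)
    {K : Type*} [Field K] [CharZero K] {x : Fin n → K} (hx : IsCasasAlvero x) (i j : Fin n) :
    x i = x j := by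
  by_contra hij
  let t : Set K := insert (x i - x j)⁻¹ (Set.range x)
  have : Algebra.FiniteType ℚ (Algebra.adjoin ℚ t) :=
    Algebra.FiniteType.adjoin_of_finite ((Set.finite_range x).insert _)
  obtain ⟨φ⟩ := nonempty_algHom_complex_of_finiteType (Algebra.adjoin ℚ t)
  let y : Fin n → Algebra.adjoin ℚ t := fun k =>
    ⟨x k, Algebra.subset_adjoin (Set.mem_insert_of_mem _ (Set.mem_range_self k))⟩
  let z : Algebra.adjoin ℚ t := ⟨(x i - x j)⁻¹, Algebra.subset_adjoin (Set.mem_insert _ _)⟩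
  have hy : IsCasasAlvero y :=
    IsCasasAlvero.of_map_injective (Algebra.adjoin ℚ t).val.toRingHom Subtype.val_injective hx
  have hz : (y i - y j) * z = 1 := Subtype.ext (mul_inv_cancel₀ (sub_ne_zero.mpr hij))
  have hφ := congrArg φ hz
  rw [map_mul, map_sub, map_one, show φ (y i) = φ (y j) from H _ (hy.map φ.toRingHom) i j,
    sub_self, zero_mul] at hφ
  exact zero_ne_one hφ

/-- The ideal of finitely supported functions in a product of rings. -/
def finiteSupportIdeal {ι : Type*} (F : ι → Type*) [∀ s, CommRing (F s)] :
    Ideal (∀ s, F s) where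
  carrier := {f | {s | f s ≠ 0}.Finite}
  zero_mem' := by simp
  add_mem' {f g} hf hg := (Set.Finite.union hf hg).subset fun s hs => by
    by_contra h
    simp only [Set.mem_union, Set.mem_ofPred_eq, not_or, not_not] at h
    exact hs (by simp [h.1, h.2])
  smul_mem' c f hf := Set.Finite.subset hf fun s hs h => hs (by simp [h])

theorem charZero_quotient_of_finiteSupportIdeal_le {ι : Type*} {F : ι → Type*}
    [∀ s, Field (F s)] (hF : ∀ m : ℕ, m ≠ 0 → {s | (m : F s) = 0}.Finite)
    {M : Ideal (∀ s, F s)} (hM : M ≠ ⊤) (hle : finiteSupportIdeal F ≤ M) :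
    CharZero ((∀ s, F s) ⧸ M) := by
  classical
  refine charZero_of_inj_zero fun m hm => ?_
  by_contra hm0
  rw [← map_natCast (Ideal.Quotient.mk M), Ideal.Quotient.eq_zero_iff_mem] at hm
  let e : ∀ s, F s := fun s => if (m : F s) = 0 then 1 else 0
  have he : e ∈ M := hle ((hF m hm0).subset fun s hs => by
    by_contra h
    exact hs (if_neg h))
  refine hM (Ideal.eq_top_of_isUnit_mem M (M.add_mem hm he) (Pi.isUnit_iff.mpr fun s => ?_))
  by_cases h : (m : F s) = 0 <;> simp [e, h]

/-- In a family of fields where each nonzero natural number vanishes only finitely often,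
Casas-Alvero tuples whose `i`-th and `j`-th entries all differ exist only if the family is finite. -/
theorem finite_of_isCasasAlvero_apply_ne {n : ℕ}
    (H : ∀ x : Fin n → ℂ, IsCasasAlvero x → ∀ i j : Fin n, x i = x j)
    {ι : Type*} {F : ι → Type*} [∀ s, Field (F s)]
    (hF : ∀ m : ℕ, m ≠ 0 → {s | (m : F s) = 0}.Finite)
    {a : ∀ s, Fin n → F s} (ha : ∀ s, IsCasasAlvero (a s)) {i j : Fin n}
    (hij : ∀ s, a s i ≠ a s j) : Finite ι := by
  by_contra hfin
  have hI : finiteSupportIdeal F ≠ ⊤ := fun h => hfin <| by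
    have h1 : (1 : ∀ s, F s) ∈ finiteSupportIdeal F := h ▸ Submodule.mem_top
    have h2 : {s | (1 : ∀ s, F s) s ≠ 0}.Finite := h1
    simpa [Set.finite_univ_iff] using h2
  obtain ⟨M, hM, hle⟩ := Ideal.exists_le_maximal _ hI
  let := Ideal.Quotient.field M
  have := charZero_quotient_of_finiteSupportIdeal_le hF hM.ne_top hle
  let x : Fin n → ∀ s, F s := fun k s => a s k
  have hx : IsCasasAlvero fun k => Ideal.Quotient.mk M (x k) := by
    rw [isCasasAlvero_iff_prod_eq_zero]
    intro l hl hln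
    have hprod : ∏ k, (hasseDeriv l (∏ j, (X - C (x j)))).eval (x k) = 0 := by
      ext s
      rw [Finset.prod_apply]
      exact (Finset.prod_congr rfl fun k _ =>
        map_eval_hasseDeriv_prod_X_sub_C (Pi.evalRingHom F s) x l k).trans
        ((isCasasAlvero_iff_prod_eq_zero (a s)).mp (ha s) l hl hln)
    have hmk := (map_prod (Ideal.Quotient.mk M) _ _).symm.trans
      ((congrArg (Ideal.Quotient.mk M) hprod).trans (map_zero _))
    simpa only [map_eval_hasseDeriv_prod_X_sub_C] using hmk
  have hmem : x i - x j ∈ M := Ideal.Quotient.eq.mp (hx.apply_eq_of_charZero H i j)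
  exact hM.ne_top (Ideal.eq_top_of_isUnit_mem M hmem
    (Pi.isUnit_iff.mpr fun s => (sub_ne_zero.mpr (hij s)).isUnit))

theorem exists_bound_isCasasAlvero_apply_eq {n : ℕ}
    (H : ∀ x : Fin n → ℂ, IsCasasAlvero x → ∀ i j : Fin n, x i = x j) (i j : Fin n) :
    ∃ N : ℕ, ∀ p : ℕ, N < p → p.Prime → ∀ a : Fin n → ZMod p, IsCasasAlvero a → a i = a j := by
  let S : Set ℕ := {p | p.Prime ∧ ∃ a : Fin n → ZMod p, IsCasasAlvero a ∧ a i ≠ a j}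
  have (s : S) : Fact (s : ℕ).Prime := ⟨s.2.1⟩
  choose a ha hij using fun s : S => s.2.2
  have hS : S.Finite := finite_of_isCasasAlvero_apply_ne H (F := fun s : S => ZMod s)
    (fun m hm => by
      refine Set.Finite.of_finite_image (f := Subtype.val) ?_ Subtype.val_injective.injOn
      refine (Set.finite_Iic m).subset ?_
      rintro _ ⟨s, hs, rfl⟩
      exact Nat.le_of_dvd (Nat.pos_of_ne_zero hm) ((ZMod.natCast_eq_zero_iff m s).mp hs)) ha hij
  obtain ⟨N, hN⟩ := hS.bddAbove
  refine ⟨N, fun p hNp hp a ha => ?_⟩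
  by_contra h
  exact hNp.not_ge (hN ⟨hp, a, ha, h⟩)

/-- If every Casas-Alvero tuple in `ℂⁿ` has all entries equal, then there
is a bound `N` such that for every prime `p > N` the number of Casas-Alvero tuples in `𝔽_pⁿ`
is exactly `p`. -/
theorem branch_count_of_casasAlvero (n : ℕ) (hn : 1 ≤ n)
    (H : ∀ x : Fin n → ℂ, IsCasasAlvero x → ∀ i j : Fin n, x i = x j) :
    ∃ N : ℕ, ∀ p : ℕ, N < p → p.Prime →
      Nat.card {a : Fin n → ZMod p // IsCasasAlvero a} = p := by
  choose N hN using exists_bound_isCasasAlvero_apply_eq H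
  let o : Fin n := ⟨0, hn⟩
  refine ⟨Finset.univ.sup (N o), fun p hNp hp => ?_⟩
  let e : {a : Fin n → ZMod p // IsCasasAlvero a} ≃ ZMod p :=
    { toFun := fun a => a.1 o
      invFun := fun c => ⟨fun _ => c, isCasasAlvero_const n c⟩
      left_inv := fun a => Subtype.ext <| funext fun k =>
        hN o k p ((Finset.le_sup (Finset.mem_univ k)).trans_lt hNp) hp a.1 a.2
      right_inv := fun _ => rfl }
  rw [Nat.card_congr e, Nat.card_zmod]
end

section
/- Fix n ≥ 1. Suppose that for every Casas-Alvero tuple (x_1,…,x_n) ∈ ℤ^n there exists an integer m ≥ 2 such that x_1 ≡ x_2 ≡ ⋯ ≡ x_n (mod m). Then every Casas-Alvero tuple in ℚ^n has all entries equal. -/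
open Polynomial

/-- Evaluating a Hasse derivative of a monic split polynomial at `r` only involves the
differences between `r` and the roots. -/
lemma eval_hasseDeriv_prod_X_sub_C {R : Type*} [CommRing R] {n : ℕ} (x : Fin n → R) (r : R)
    (i : ℕ) :
    (hasseDeriv i (∏ j : Fin n, (X - C (x j)))).eval r =
      (∏ j : Fin n, (X + C (r - x j))).coeff i := by
  rw [← taylor_coeff, taylor_apply, prod_comp]
  congr 1
  refine Finset.prod_congr rfl fun j _ => ?_
  simp only [sub_comp, X_comp, C_comp, C_sub]
  ring

lemma pow_mul_coeff_prod_X_add_C_mul {R : Type*} [CommRing R] {n : ℕ} (a : R) (z : Fin n → R)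
    (i : ℕ) :
    (∏ j : Fin n, (X + C (a * z j))).coeff i * a ^ i =
      a ^ n * (∏ j : Fin n, (X + C (z j))).coeff i := by
  rw [← comp_C_mul_X_coeff, prod_comp, ← coeff_C_mul]
  congr 1
  calc _ = ∏ j : Fin n, (C a * (X + C (z j))) := by
        refine Finset.prod_congr rfl fun j _ => ?_
        rw [add_comp, X_comp, C_comp, C_mul]
        ring
    _ = _ := by simp [Finset.prod_mul_distrib]

/-- Being a Casas-Alvero tuple is invariant under affine changes of variable. -/
lemma IsCasasAlvero.of_sub_eq_mul_sub {R : Type*} [CommRing R] [IsDomain R] {n : ℕ}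
    {x y : Fin n → R} (hx : IsCasasAlvero x) {a : R} (ha : a ≠ 0)
    (h : ∀ k j, y k - y j = a * (x k - x j)) : IsCasasAlvero y := by
  intro i hi hin
  obtain ⟨k, hk⟩ := hx i hi hin
  refine ⟨k, ?_⟩
  rw [eval_hasseDeriv_prod_X_sub_C] at hk ⊢
  have key := pow_mul_coeff_prod_X_add_C_mul a (fun j => x k - x j) i
  rw [hk, mul_zero] at key
  simp only [h]
  exact (mul_eq_zero.mp key).resolve_right (pow_ne_zero i ha)

/-- If every integral Casas-Alvero tuple has all entries congruent modulo
some `m ≥ 2`, then every rational Casas-Alvero tuple has all entries equal. -/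
theorem casasAlvero_rat_of_int_congruence (n : ℕ) (hn : 1 ≤ n)
    (H : ∀ x : Fin n → ℤ, IsCasasAlvero (fun i => (x i : ℚ)) →
      ∃ m : ℤ, 2 ≤ m ∧ ∀ i j : Fin n, x i ≡ x j [ZMOD m]) :
    ∀ x : Fin n → ℚ, IsCasasAlvero x → ∀ i j : Fin n, x i = x j := by
  intro x hx
  let i₀ : Fin n := ⟨0, hn⟩
  suffices hall : ∀ i, x i = x i₀ from fun i j => (hall i).trans (hall j).symm
  obtain ⟨⟨d, hd⟩, hmul⟩ := IsLocalization.exist_integer_multiples_of_finite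
    (nonZeroDivisors ℤ) (fun i => x i - x i₀)
  have hd0 : (d : ℚ) ≠ 0 := by exact_mod_cast nonZeroDivisors.ne_zero hd
  choose w hw using hmul
  have hw' : ∀ i, (w i : ℚ) = d * (x i - x i₀) := fun i => by simpa using hw i
  obtain ⟨g, hg, hg1⟩ := Finset.extract_gcd w (s := Finset.univ) ⟨i₀, Finset.mem_univ _⟩
  by_cases hG : Finset.univ.gcd w = 0
  · intro i
    have hwi : w i = 0 := Finset.gcd_eq_zero_iff.mp hG i (Finset.mem_univ i)
    have := hw' i
    rw [hwi, Int.cast_zero, eq_comm, mul_eq_zero] at this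
    exact sub_eq_zero.mp (this.resolve_left hd0)
  · exfalso
    set G := Finset.univ.gcd w
    have hGQ : (G : ℚ) ≠ 0 := by exact_mod_cast hG
    have hgQ : ∀ i, (G : ℚ) * g i = d * (x i - x i₀) := fun i => by
      rw [← hw' i, hg i (Finset.mem_univ i)]
      push_cast
      rfl
    have hCA : IsCasasAlvero (fun i => (g i : ℚ)) := by
      refine hx.of_sub_eq_mul_sub (div_ne_zero hd0 hGQ) fun k j => ?_
      field_simp
      linear_combination hgQ k - hgQ j
    obtain ⟨m, hm, hcong⟩ := H g hCA
    have hg0 : g i₀ = 0 := by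
      have := hgQ i₀
      rw [sub_self, mul_zero, mul_eq_zero] at this
      exact_mod_cast this.resolve_left hGQ
    have hdvd : m ∣ Finset.univ.gcd g := Finset.dvd_gcd fun i _ => by
      simpa [hg0] using (hcong i₀ i).dvd
    rw [hg1] at hdvd
    have := Int.le_of_dvd one_pos hdvd
    omega
end

section
/- Let 𝔽_q be a finite field with q elements and let J be an ideal of 𝔽_q[x_1,…,x_n]. Then the vanishing ideal of the zero locus of J in 𝔽_q^n equals J + ⟨x_1^q − x_1, …, x_n^q − x_n⟩; that is, I(V(J)) = J + ⟨x_1^q − x_1, …, x_n^q − x_n⟩. -/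
open MvPolynomial

/-- The product of `X - r` over all elements `r` of a finite field of order `q` is `X ^ q - X`. -/
theorem FiniteField.prod_X_sub_C_eq_X_pow_card_sub_X (K : Type*) [Field K] [Fintype K] :
    ∏ r : K, (Polynomial.X - Polynomial.C r) = Polynomial.X ^ Fintype.card K - Polynomial.X := by
  have hroots := FiniteField.roots_X_pow_card_sub_X K
  have hmonic : (Polynomial.X ^ Fintype.card K - Polynomial.X : Polynomial K).Monic :=
    Polynomial.monic_X_pow_sub (by simpa using Fintype.one_lt_card (α := K))
  have h := Polynomial.prod_multiset_X_sub_C_of_monic_of_roots_card_eq hmonic (by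
    rw [hroots, FiniteField.X_pow_card_sub_X_natDegree_eq K Fintype.one_lt_card]; rfl)
  rwa [hroots] at h

/-- A polynomial over a finite field that vanishes at every point lies in the ideal of field
equations. -/
theorem MvPolynomial.mem_span_X_pow_card_sub_X_of_eval_eq_zero {K σ : Type*} [Field K] [Fintype K]
    [Finite σ] {f : MvPolynomial σ K} (hf : ∀ a : σ → K, eval a f = 0) :
    f ∈ Ideal.span (Set.range fun i : σ =>
      (X i ^ Fintype.card K - X i : MvPolynomial σ K)) := by
  have hprod (i : σ) : ∏ r : K, (X i - C r : MvPolynomial σ K) = X i ^ Fintype.card K - X i := by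
    simpa [map_prod] using
      congrArg (Polynomial.aeval (X i : MvPolynomial σ K))
        (FiniteField.prod_X_sub_C_eq_X_pow_card_sub_X K)
  obtain ⟨h, -, rfl⟩ := combinatorial_nullstellensatz_exists_linearCombination
    (fun _ : σ => (Finset.univ : Finset K)) (fun _ => Finset.univ_nonempty) f fun a _ => hf a
  simp only [hprod]
  exact Finsupp.mem_span_range_iff_exists_finsupp.2 ⟨h, rfl⟩

/-- **Nullstellensatz in finite fields.** For an ideal `J` of `𝔽_q[x₁,…,xₙ]`,
the vanishing ideal of the zero locus of `J` equals `J + ⟨x₁^q - x₁, …, xₙ^q - xₙ⟩`. -/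
theorem finite_field_nullstellensatz (K : Type*) [Field K] [Fintype K] (q : ℕ)
    (hq : Fintype.card K = q) (n : ℕ) (J : Ideal (MvPolynomial (Fin n) K)) :
    ∀ f : MvPolynomial (Fin n) K,
      (f ∈ J ⊔ Ideal.span (Set.range fun i : Fin n =>
          (MvPolynomial.X i ^ q - MvPolynomial.X i : MvPolynomial (Fin n) K))) ↔
        ∀ a : Fin n → K, (∀ g ∈ J, MvPolynomial.eval a g = 0) → MvPolynomial.eval a f = 0 := by
  subst hq
  intro f
  constructor
  · intro hf a ha
    have hle : J ⊔ Ideal.span (Set.range fun i : Fin n =>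
        (X i ^ Fintype.card K - X i : MvPolynomial (Fin n) K)) ≤ RingHom.ker (eval a) := by
      refine sup_le ha (Ideal.span_le.2 ?_)
      rintro _ ⟨i, rfl⟩
      simp [RingHom.mem_ker, FiniteField.pow_card]
    exact hle hf
  · intro hf
    have hex (a : Fin n → K) : ∃ g ∈ J, eval a g = eval a f := by
      by_cases ha : ∀ g ∈ J, eval a g = 0
      · exact ⟨0, J.zero_mem, by rw [hf a ha, map_zero]⟩
      · push Not at ha
        obtain ⟨g, hg, hga⟩ := ha
        exact ⟨C (eval a f / eval a g) * g, J.mul_mem_left _ hg, by simp [hga]⟩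
    choose g hgJ hg using hex
    have hmem : ∑ a, indicator a * g a ∈ J := J.sum_mem fun a _ => J.mul_mem_left _ (hgJ a)
    rw [← add_sub_cancel (∑ a, indicator a * g a) f]
    refine Submodule.add_mem_sup hmem (mem_span_X_pow_card_sub_X_of_eval_eq_zero fun b => ?_)
    rw [map_sub, map_sum, Finset.sum_eq_single b]
    · simp [eval_indicator_apply_eq_one, hg]
    · intro a _ hab
      simp [eval_indicator_apply_eq_zero b a hab.symm]
    · simp
end

section
/- Let p be a prime, n ≥ 1, and fix indices i_1,…,i_{n−1} ∈ {1,…,n}. Let N be the number of tuples (a_1,…,a_n) ∈ 𝔽_p^n satisfying H_j(f)(a_{i_j}) = 0 for all j = 1,…,n−1, where f(X) = ∏_{l=1}^n (X − a_l) ∈ 𝔽_p[X]. Then N = p if and only if N < p². -/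
open Polynomial

/-- Under the affine substitution `t ↦ c * t + d`, the `j`-th Hasse derivative of
`∏ (X - a_l)` at `x` is multiplied by `c ^ (n - j)`. -/
theorem eval_hasseDeriv_prod_X_sub_C_affine {R ι : Type*} [CommRing R] [Fintype ι]
    (a : ι → R) (c d x : R) {j : ℕ} (hj : j ≤ Fintype.card ι) :
    (hasseDeriv j (∏ l, (X - C (c * a l + d)))).eval (c * x + d) =
      c ^ (Fintype.card ι - j) * (hasseDeriv j (∏ l, (X - C (a l)))).eval x := by
  have taylor_prod (b : ι → R) (y : R) :
      taylor y (∏ l, (X - C (b l))) = ∏ l, (X + C (y - b l)) := by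
    simp only [taylor_apply, prod_comp]
    exact Finset.prod_congr rfl fun l _ => by simp; ring
  rw [← taylor_coeff, ← taylor_coeff, taylor_prod, taylor_prod,
    Finset.prod_X_add_C_coeff _ _ (by simpa using hj),
    Finset.prod_X_add_C_coeff _ _ (by simpa using hj), Finset.mul_sum]
  refine Finset.sum_congr rfl fun t ht => ?_
  rw [← Finset.card_univ, ← (Finset.mem_powersetCard.mp ht).2, ← Finset.prod_const,
    ← Finset.prod_mul_distrib]
  exact Finset.prod_congr rfl fun l _ => by ring

/-- For a prime `p` and a branch given by indices `i₁,…,i_{n-1}`, the number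
`N` of tuples `(a₁,…,aₙ) ∈ 𝔽_pⁿ` with `H_j(f)(a_{i_j}) = 0` for all `j = 1,…,n-1`, where
`f(X) = ∏ (X - a_l)`, satisfies `N = p` if and only if `N < p²`. -/
theorem branch_count_eq_iff_lt_sq (p : ℕ) (hp : p.Prime) (n : ℕ) (hn : 1 ≤ n)
    (idx : Fin (n - 1) → Fin n) (N : ℕ)
    (hN : N = Nat.card {a : Fin n → ZMod p // ∀ j : Fin (n - 1),
      Polynomial.eval (a (idx j))
        (Polynomial.hasseDeriv (j.val + 1)
          (∏ l : Fin n, (Polynomial.X - Polynomial.C (a l)))) = 0}) :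
    N = p ↔ N < p ^ 2 := by
  have : Fact p.Prime := ⟨hp⟩
  set S : Set (Fin n → ZMod p) := {a | ∀ j : Fin (n - 1),
    eval (a (idx j)) (hasseDeriv (j.val + 1) (∏ l : Fin n, (X - C (a l)))) = 0}
  replace hN : N = Nat.card S := hN
  have diag_mem (d : ZMod p) : (fun _ => d) ∈ S := fun j => by
    have h := eval_hasseDeriv_prod_X_sub_C_affine (fun _ : Fin n => (0 : ZMod p)) 0 d 0
      (j := j.val + 1) (by rw [Fintype.card_fin]; omega)
    rw [zero_pow (by rw [Fintype.card_fin]; omega), zero_mul] at h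
    simpa only [zero_mul, zero_add] using h
  have affine_mem {a : Fin n → ZMod p} (ha : a ∈ S) (c d : ZMod p) :
      (fun l => c * a l + d) ∈ S := fun j => by
    rw [eval_hasseDeriv_prod_X_sub_C_affine a c d _ (by rw [Fintype.card_fin]; omega), ha j,
      mul_zero]
  refine ⟨fun h => h.trans_lt (lt_self_pow₀ hp.one_lt one_lt_two), fun hlt => ?_⟩
  have diag_of_mem {a : Fin n → ZMod p} (ha : a ∈ S) (i k : Fin n) : a i = a k := by
    by_contra hik
    refine hlt.not_ge ?_
    have hinj : Function.Injective fun q : ZMod p × ZMod p =>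
        (⟨fun l => q.1 * a l + q.2, affine_mem ha q.1 q.2⟩ : S) := by
      rintro ⟨c, d⟩ ⟨c', d'⟩ h
      have h := congrArg Subtype.val h
      have hi : c * a i + d = c' * a i + d' := congrFun h i
      have hk : c * a k + d = c' * a k + d' := congrFun h k
      have hc : c = c' := mul_right_cancel₀ (sub_ne_zero.mpr hik) (by linear_combination hi - hk)
      subst hc
      exact Prod.ext rfl (add_left_cancel hi)
    simpa [hN, sq] using Nat.card_le_card_of_injective _ hinj
  have hbij : Function.Bijective fun d : ZMod p => (⟨fun _ => d, diag_mem d⟩ : S) :=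
    ⟨fun d d' h => congrFun (congrArg Subtype.val h) ⟨0, hn⟩,
      fun ⟨a, ha⟩ => ⟨a ⟨0, hn⟩, Subtype.ext (funext fun l => diag_of_mem ha _ l)⟩⟩
  rw [hN, ← Nat.card_eq_of_bijective _ hbij, Nat.card_zmod]
end

section
/- Let n ≥ 3, let x_1,…,x_n be indeterminates over ℚ, and let f(T) = ∏_{j=1}^n (T − x_j), a polynomial in T with coefficients in ℚ[x_1,…,x_n]. Let J be the ideal of ℚ[x_1,…,x_n] generated by H_1(f)(x_{n−1}), H_2(f)(x_{n−2}), …, H_{n−1}(f)(x_1) (i.e., by H_{n−k}(f)(x_k) for k = 1,…,n−1). Fix the graded lexicographic monomial order with x_1 > x_2 > ⋯ > x_n. Then for each k = 1,…,n−1 there exists an integer m_k ≥ 1 and a nonzero polynomial g ∈ J whose leading monomial is x_k^{m_k}. -/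
open Polynomial MvPolynomial

/-- Total degree of an exponent vector. -/
def expDegree {n : ℕ} (α : Fin n →₀ ℕ) : ℕ := α.sum fun _ e => e

/-- The graded lexicographic strict order on exponent vectors, with respect to the
variable ordering `x₁ > x₂ > ⋯ > xₙ` (i.e. smaller index means bigger variable). -/
def GrlexLT {n : ℕ} (α β : Fin n →₀ ℕ) : Prop :=
  expDegree α < expDegree β ∨
    (expDegree α = expDegree β ∧
      ∃ v : Fin n, (∀ w : Fin n, w < v → α w = β w) ∧ α v < β v)

/-- `m` is the leading monomial of the polynomial `g` w.r.t. the graded lex order: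
it occurs in `g` and dominates every other monomial of `g`. -/
def IsLeadingMonomial {n : ℕ} {R : Type*} [CommSemiring R]
    (g : MvPolynomial (Fin n) R) (m : Fin n →₀ ℕ) : Prop :=
  m ∈ g.support ∧ ∀ m' ∈ g.support, m' = m ∨ GrlexLT m' m

namespace Polynomial

theorem rootSet_derivative_subset_of_convex {p : ℂ[X]} {C : Set ℂ} (hC : Convex ℝ C)
    (h : p.rootSet ℂ ⊆ C) : p.derivative.rootSet ℂ ⊆ C := by
  rcases lt_or_ge 0 p.degree with h0 | h0
  · exact (rootSet_derivative_subset_convexHull_rootSet h0).trans (convexHull_min h hC)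
  · rw [eq_C_of_degree_le_zero h0]
    simp

theorem rootSet_iterate_derivative_subset_of_convex {p : ℂ[X]} {C : Set ℂ} (hC : Convex ℝ C)
    (h : p.rootSet ℂ ⊆ C) (i : ℕ) : (derivative^[i] p).rootSet ℂ ⊆ C := by
  induction i with
  | zero => exact h
  | succ i ih =>
    rw [Function.iterate_succ_apply']
    exact rootSet_derivative_subset_of_convex hC ih

/-- A derivative of order at most the degree vanishes at an extreme point of the convex hull of the
roots only if the order is smaller than the multiplicity. -/
theorem lt_rootMultiplicity_of_mem_extremePoints {p : ℂ[X]} {v : ℂ}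
    (hv : v ∈ (convexHull ℝ (p.rootSet ℂ)).extremePoints ℝ) {i : ℕ} (hi : i ≤ p.natDegree)
    (hp : p ≠ 0) (hroot : (derivative^[i] p).IsRoot v) : i < p.rootMultiplicity v := by
  by_contra! hlt
  set S := convexHull ℝ (p.rootSet ℂ)
  have hC : Convex ℝ (S \ {v}) :=
    ((convex_convexHull ℝ _).mem_extremePoints_iff_convex_sdiff.1 hv).2
  have hbase : (derivative^[p.rootMultiplicity v] p).rootSet ℂ ⊆ S \ {v} := by
    refine Set.subset_sdiff_singleton (rootSet_iterate_derivative_subset_of_convex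
      (convex_convexHull ℝ _) (subset_convexHull ℝ _) _) fun hmem => ?_
    refine lt_irrefl (p.rootMultiplicity v)
      ((lt_rootMultiplicity_iff_isRoot_iterate_derivative hp).2 fun m hm => ?_)
    rcases hm.lt_or_eq with hm | rfl
    · exact isRoot_iterate_derivative_of_lt_rootMultiplicity hm
    · simpa [mem_rootSet, coe_aeval_eq_eval] using (mem_rootSet.1 hmem).2
  have hsub := rootSet_iterate_derivative_subset_of_convex hC hbase (i - p.rootMultiplicity v)
  rw [← Function.iterate_add_apply, Nat.sub_add_cancel hlt] at hsub
  have hne : derivative^[i] p ≠ 0 := fun h0 => by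
    have hc := coeff_iterate_derivative (p := p) (k := i) (p.natDegree - i)
    rw [h0, Nat.sub_add_cancel hi, coeff_zero, coeff_natDegree, eq_comm, smul_eq_zero] at hc
    rcases hc with hc | hc
    · exact (Nat.descFactorial_eq_zero_iff_lt.1 hc).not_ge hi
    · exact hp (leadingCoeff_eq_zero.1 hc)
  exact (hsub (mem_rootSet.2 ⟨hne, by simpa [coe_aeval_eq_eval] using hroot⟩)).2 rfl

theorem hasseDeriv_map {R S : Type*} [Semiring R] [Semiring S] (φ : R →+* S) (p : R[X]) (i : ℕ) :
    hasseDeriv i (p.map φ) = (hasseDeriv i p).map φ := by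
  ext m
  simp [hasseDeriv_coeff]

theorem rootMultiplicity_prod_X_sub_C {ι R : Type*} [Fintype ι] [CommRing R] [IsDomain R]
    [DecidableEq R] (x : ι → R) (v : R) :
    (∏ j, (X - C (x j))).rootMultiplicity v = (Finset.univ.filter fun j => x j = v).card := by
  have h : (∏ j, (X - C (x j))).roots = Finset.univ.val.map x := by
    rw [← roots_multiset_prod_X_sub_C (Finset.univ.val.map x), Multiset.map_map]
    rfl
  rw [← count_roots, h, Multiset.count_map]
  simp only [eq_comm (a := v)]
  rfl

/-- If each `x k` with `k < d` is a root of the `(d - k)`-th derivative of `∏ (X - x j)`,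
then all the `x j` coincide. -/
theorem eq_last_of_isRoot_hasseDeriv {d : ℕ} (x : Fin (d + 1) → ℂ)
    (h : ∀ k : Fin (d + 1), k.val < d →
      (hasseDeriv (d - k.val) (∏ j, (X - C (x j)))).IsRoot (x k)) (j : Fin (d + 1)) :
    x j = x (Fin.last d) := by
  set p : ℂ[X] := ∏ j, (X - C (x j)) with hpdef
  have hp : p.Monic := monic_prod_of_monic _ _ fun j _ => monic_X_sub_C (x j)
  have hdeg : p.natDegree = d + 1 := by
    rw [hpdef, natDegree_prod_of_monic _ _ fun j _ => monic_X_sub_C (x j)]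
    simp
  have hroots : ∀ z, z ∈ p.rootSet ℂ ↔ ∃ k, x k = z := fun z => by
    rw [mem_rootSet, and_iff_right hp.ne_zero, coe_aeval_eq_eval, hpdef, eval_prod,
      Finset.prod_eq_zero_iff]
    simp [sub_eq_zero, eq_comm]
  have hder : ∀ k : Fin (d + 1), (derivative^[d - k.val] p).IsRoot (x k) := fun k => by
    rcases k.is_le.lt_or_eq with hk | hk
    · rw [← factorial_smul_hasseDeriv, LinearMap.smul_apply, IsRoot, eval_smul, h k hk, smul_zero]
    · rw [hk, Nat.sub_self, Function.iterate_zero_apply]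
      simpa [hp.ne_zero, mem_rootSet] using (hroots (x k)).2 ⟨k, rfl⟩
  set S := convexHull ℝ (p.rootSet ℂ) with hS
  have hext : S.extremePoints ℝ ⊆ {x (Fin.last d)} := fun v hv => by
    obtain ⟨k₀, hk₀⟩ := (hroots v).1 (extremePoints_convexHull_subset hv)
    set A := Finset.univ.filter fun j => x j = v
    have hcard : p.rootMultiplicity v = A.card := rootMultiplicity_prod_X_sub_C x v
    have hA : ∀ k ∈ A, d - k.val < A.card := fun k hk => by
      rw [← hcard]
      refine lt_rootMultiplicity_of_mem_extremePoints hv (by omega) hp.ne_zero ?_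
      rw [← (Finset.mem_filter.1 hk).2]
      exact hder k
    have himg : A.image (fun k => d - k.val) = Finset.range A.card := by
      refine Finset.eq_of_subset_of_card_le (fun i hi => ?_) ?_
      · obtain ⟨k, hk, rfl⟩ := Finset.mem_image.1 hi
        exact Finset.mem_range.2 (hA k hk)
      · rw [Finset.card_range, Finset.card_image_of_injective]
        intro a b hab
        ext
        have := a.is_le
        have := b.is_le
        simp only at hab
        omega
    have h0 : 0 ∈ A.image (fun k => d - k.val) := by
      rw [himg, Finset.mem_range, Finset.card_pos]
      exact ⟨k₀, by simp [A, hk₀]⟩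
    obtain ⟨k, hk, hk0⟩ := Finset.mem_image.1 h0
    have hlast : k = Fin.last d := by
      ext
      have := k.is_le
      simp only [Fin.val_last]
      omega
    rw [Set.mem_singleton_iff, ← hlast, (Finset.mem_filter.1 hk).2]
  have hcompact : IsCompact S := (p.rootSet_finite ℂ).isCompact_convexHull ℝ
  have hclosure := closure_convexHull_extremePoints hcompact (convex_convexHull ℝ _)
  have hmem : x j ∈ S := subset_convexHull ℝ _ ((hroots _).2 ⟨j, rfl⟩)
  rw [← hclosure] at hmem
  simpa using closure_mono (convexHull_mono hext) hmem

end Polynomial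

theorem support_X_sub_X_pow {n : ℕ} {R : Type*} [CommRing R] (k l : Fin n) (m : ℕ) :
    ∀ α ∈ ((MvPolynomial.X k - MvPolynomial.X l : MvPolynomial (Fin n) R) ^ m).support,
      ∃ a b, a + b = m ∧ α = Finsupp.single k a + Finsupp.single l b := by
  induction m with
  | zero =>
    intro α hα
    refine ⟨0, 0, rfl, ?_⟩
    rw [pow_zero, MvPolynomial.mem_support_iff, MvPolynomial.coeff_one] at hα
    simpa [eq_comm] using (ite_ne_right_iff.1 hα).1
  | succ m ih =>
    intro α hα
    rw [pow_succ, mul_sub] at hα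
    rcases Finset.mem_union.1 (MvPolynomial.support_sub _ _ _ hα) with hα | hα <;>
      rw [MvPolynomial.support_mul_X, Finset.mem_map] at hα <;>
      obtain ⟨β, hβ, rfl⟩ := hα <;>
      obtain ⟨a, b, hab, rfl⟩ := ih β hβ
    · refine ⟨a + 1, b, by omega, ?_⟩
      simp only [addRightEmbedding_apply, Finsupp.single_add]
      abel
    · refine ⟨a, b + 1, by omega, ?_⟩
      simp only [addRightEmbedding_apply, Finsupp.single_add]
      abel

theorem coeff_single_X_sub_X_pow {n : ℕ} {R : Type*} [CommRing R] {k l : Fin n} (hkl : k ≠ l)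
    (m : ℕ) :
    MvPolynomial.coeff (Finsupp.single k m)
      ((MvPolynomial.X k - MvPolynomial.X l : MvPolynomial (Fin n) R) ^ m) = 1 := by
  induction m with
  | zero => simp
  | succ m ih =>
    rw [pow_succ, mul_sub, MvPolynomial.coeff_sub, MvPolynomial.coeff_mul_X' _ l, if_neg,
      Finsupp.single_add, MvPolynomial.coeff_mul_X, ih, sub_zero]
    simp [hkl]

theorem isLeadingMonomial_X_sub_X_pow {n : ℕ} {R : Type*} [CommRing R] [Nontrivial R]
    {k l : Fin n} (hkl : k < l) (m : ℕ) :
    IsLeadingMonomial ((MvPolynomial.X k - MvPolynomial.X l : MvPolynomial (Fin n) R) ^ m)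
      (Finsupp.single k m) := by
  refine ⟨?_, fun α hα => ?_⟩
  · rw [MvPolynomial.mem_support_iff, coeff_single_X_sub_X_pow hkl.ne]
    exact one_ne_zero
  · obtain ⟨a, b, rfl, rfl⟩ := support_X_sub_X_pow k l m α hα
    rcases Nat.eq_zero_or_pos b with rfl | hb
    · simp
    · refine Or.inr (Or.inr ⟨?_, k, fun w hw => ?_, ?_⟩)
      · simp [expDegree, Finsupp.sum_add_index', Finsupp.sum_single_index]
      · simp [hw.ne, (hw.trans hkl).ne]
      · simp [hkl.ne, hb]

theorem X_sub_X_last_mem_radical {d : ℕ} (J : Ideal (MvPolynomial (Fin (d + 1)) ℚ))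
    (hJ : ∀ k : Fin (d + 1), k.val < d → Polynomial.eval (MvPolynomial.X k)
      (Polynomial.hasseDeriv (d - k.val)
        (∏ j : Fin (d + 1), (Polynomial.X - Polynomial.C (MvPolynomial.X j)))) ∈ J)
    (k : Fin (d + 1)) : MvPolynomial.X k - MvPolynomial.X (Fin.last d) ∈ J.radical := by
  rw [← MvPolynomial.vanishingIdeal_zeroLocus_eq_radical (K := ℂ),
    MvPolynomial.mem_vanishingIdeal_iff]
  intro x hx
  rw [map_sub, MvPolynomial.aeval_X, MvPolynomial.aeval_X, sub_eq_zero]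
  refine Polynomial.eq_last_of_isRoot_hasseDeriv x (fun i hi => ?_) k
  have h := hx _ (hJ i hi)
  rw [← AlgHom.coe_toRingHom, ← Polynomial.eval_map_apply, ← Polynomial.hasseDeriv_map] at h
  simpa [Polynomial.map_prod] using h

/-- For `n ≥ 3`, `f(T) = ∏ (T - xⱼ)` over `ℚ[x₁,…,xₙ]` and the ideal `J`
generated by `H_{n-k}(f)(x_k)` for `k = 1,…,n-1`, for each `k = 1,…,n-1` there is `m_k ≥ 1`
and a nonzero `g ∈ J` whose leading monomial (for graded lex with `x₁ > ⋯ > xₙ`) is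
`x_k^{m_k}`. -/
theorem leading_powers_special_branch (n : ℕ) (hn : 3 ≤ n)
    (f : Polynomial (MvPolynomial (Fin n) ℚ))
    (hf : f = ∏ j : Fin n, (Polynomial.X - Polynomial.C (MvPolynomial.X j)))
    (J : Ideal (MvPolynomial (Fin n) ℚ))
    (hJ : J = Ideal.span ((fun k : Fin n =>
      Polynomial.eval (MvPolynomial.X k) (Polynomial.hasseDeriv (n - 1 - k.val) f)) ''
        {k : Fin n | k.val < n - 1})) :
    ∀ k : Fin n, k.val < n - 1 → ∃ m : ℕ, 1 ≤ m ∧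
      ∃ g ∈ J, g ≠ 0 ∧ IsLeadingMonomial g (Finsupp.single k m) := by
  obtain ⟨d, rfl⟩ : ∃ d, n = d + 1 := ⟨n - 1, by omega⟩
  intro k hk
  have hmem : ∀ i : Fin (d + 1), i.val < d → Polynomial.eval (MvPolynomial.X i)
      (Polynomial.hasseDeriv (d - i.val)
        (∏ j : Fin (d + 1), (Polynomial.X - Polynomial.C (MvPolynomial.X j)))) ∈ J := by
    intro i hi
    rw [hJ, ← hf]
    exact Ideal.subset_span ⟨i, hi, rfl⟩
  obtain ⟨m, hm⟩ := X_sub_X_last_mem_radical J hmem k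
  have hlead := isLeadingMonomial_X_sub_X_pow (R := ℚ) (show k < Fin.last d from hk) (m + 1)
  refine ⟨m + 1, by omega, _, ?_, fun h0 => ?_, hlead⟩
  · rw [pow_succ]
    exact J.mul_mem_right _ hm
  · simpa [h0] using hlead.1
end

section
/- Let n ≥ 3, let x_1,…,x_n be indeterminates over ℚ, and let f(T) = ∏_{j=1}^n (T − x_j). Let φ : ℚ[x_1,…,x_n] → ℚ[x_2,…,x_n] be the substitution homomorphism sending x_1 to (x_2 + ⋯ + x_n)/(n−1) and fixing x_2,…,x_n. Then φ(H_{n−2}(f)(x_2)) = G_2·x_2² + G_1·x_2 + G_0, where G_2 is the constant (n−2)(n²−2n−1)/(2(n−1)), and G_1, G_0 ∈ ℚ[x_3,…,x_n] are homogeneous polynomials of degrees 1 and 2 respectively. In particular G_2 ≠ 0 for n ≥ 3. -/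
open Polynomial MvPolynomial

/-- The Hasse derivative of order `m` of the generic monic split polynomial of degree `m + 2`,
expressed through the power sums of its roots. -/
lemma two_mul_eval_hasseDeriv_prod_X_sub_C (m : ℕ) (t : MvPolynomial (Fin (m + 2)) ℚ) :
    2 * Polynomial.eval t (Polynomial.hasseDeriv m
      (∏ j : Fin (m + 2), (Polynomial.X - Polynomial.C (MvPolynomial.X j)))) =
      ((m : MvPolynomial (Fin (m + 2)) ℚ) + 2) * ((m : MvPolynomial (Fin (m + 2)) ℚ) + 1) * t ^ 2 -
        2 * ((m : MvPolynomial (Fin (m + 2)) ℚ) + 1) * (∑ j : Fin (m + 2), MvPolynomial.X j) * t +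
        ((∑ j : Fin (m + 2), MvPolynomial.X j) ^ 2 - ∑ j : Fin (m + 2), MvPolynomial.X j ^ 2) := by
  set f : Polynomial (MvPolynomial (Fin (m + 2)) ℚ) :=
    ∏ j : Fin (m + 2), (Polynomial.X - Polynomial.C (MvPolynomial.X j)) with hf
  have hdeg : f.natDegree = m + 2 := by simp [hf]
  have hcoeff (k : ℕ) (hk : k ≤ m + 2) :
      f.coeff k = (-1) ^ (m + 2 - k) * MvPolynomial.esymm (Fin (m + 2)) ℚ (m + 2 - k) := by
    have h := Multiset.prod_X_sub_C_coeff
      (Finset.univ.val.map fun j : Fin (m + 2) => (MvPolynomial.X j : MvPolynomial _ ℚ))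
      (k := k) (by simpa using hk)
    rw [MvPolynomial.esymm_eq_multiset_esymm]
    simpa [hf, Finset.prod, Multiset.map_map, Function.comp_def] using h
  have hd : (Polynomial.hasseDeriv m f).natDegree < 3 := by
    have := Polynomial.natDegree_hasseDeriv_le f m
    omega
  have he : 2 * MvPolynomial.esymm (Fin (m + 2)) ℚ 2 =
      (∑ j : Fin (m + 2), MvPolynomial.X j) ^ 2 - ∑ j : Fin (m + 2), MvPolynomial.X j ^ 2 := by
    have h := MvPolynomial.mul_esymm_eq_sum (Fin (m + 2)) ℚ 2
    have hs : (Finset.HasAntidiagonal.antidiagonal 2).filter (fun a : ℕ × ℕ => a.1 < 2) = ({(0, 2), (1, 1)} : Finset (ℕ × ℕ)) := by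
      decide
    rw [hs, Finset.sum_pair (by decide)] at h
    simp only [MvPolynomial.psum, MvPolynomial.esymm_zero, MvPolynomial.esymm_one, pow_one] at h
    push_cast at h
    linear_combination h
  have hc : (((m + 2).choose m : ℕ) : MvPolynomial (Fin (m + 2)) ℚ) * 2 =
      ((m : MvPolynomial (Fin (m + 2)) ℚ) + 2) * ((m : MvPolynomial (Fin (m + 2)) ℚ) + 1) := by
    have h2 : (m + 2).choose m * 2 = (m + 2) * (m + 1) := by
      rw [Nat.choose_symm_add, Nat.choose_two_right]
      exact Nat.div_mul_cancel (Nat.even_mul_pred_self (m + 2)).two_dvd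
    exact_mod_cast congrArg (Nat.cast (R := MvPolynomial (Fin (m + 2)) ℚ)) h2
  rw [Polynomial.eval_eq_sum_range' hd]
  simp only [Finset.sum_range_succ, Finset.sum_range_zero, Polynomial.hasseDeriv_coeff]
  rw [hcoeff (0 + m) (by omega), hcoeff (1 + m) (by omega), hcoeff (2 + m) (by omega),
    show m + 2 - (0 + m) = 2 by omega, show m + 2 - (1 + m) = 1 by omega,
    show m + 2 - (2 + m) = 0 by omega, Nat.zero_add, add_comm 2 m, add_comm 1 m, Nat.choose_self,
    Nat.choose_succ_self_right, MvPolynomial.esymm_zero, MvPolynomial.esymm_one]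
  push_cast
  linear_combination he + t ^ 2 * hc

/-- For `n ≥ 3` and `f(T) = ∏ (T - xⱼ)` over `ℚ[x₁,…,xₙ]`, substituting
`x₁ ↦ (x₂ + ⋯ + xₙ)/(n-1)` into `H_{n-2}(f)(x₂)` yields `G₂·x₂² + G₁·x₂ + G₀`, where
`G₂ = (n-2)(n²-2n-1)/(2(n-1))` is a nonzero constant and `G₁, G₀ ∈ ℚ[x₃,…,xₙ]` are
homogeneous of degrees `1` and `2` respectively. -/
theorem substituted_hasse_deriv_quadratic (n : ℕ) (hn : 3 ≤ n)
    (f : Polynomial (MvPolynomial (Fin n) ℚ))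
    (hf : f = ∏ j : Fin n, (Polynomial.X - Polynomial.C (MvPolynomial.X j)))
    (φ : MvPolynomial (Fin n) ℚ →ₐ[ℚ] MvPolynomial (Fin n) ℚ)
    (hφ : φ = MvPolynomial.aeval (fun v : Fin n =>
      if v.val = 0 then
        MvPolynomial.C ((n : ℚ) - 1)⁻¹ *
          ∑ j ∈ Finset.univ.filter (fun j : Fin n => j.val ≠ 0), MvPolynomial.X j
      else MvPolynomial.X v))
    (G₂ : ℚ) (hG₂ : G₂ = ((n : ℚ) - 2) * ((n : ℚ) ^ 2 - 2 * (n : ℚ) - 1) / (2 * ((n : ℚ) - 1))) :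
    ∃ G₁ G₀ : MvPolynomial (Fin n) ℚ,
      G₁ ∈ MvPolynomial.supported ℚ {v : Fin n | 2 ≤ v.val} ∧
      G₀ ∈ MvPolynomial.supported ℚ {v : Fin n | 2 ≤ v.val} ∧
      MvPolynomial.IsHomogeneous G₁ 1 ∧ MvPolynomial.IsHomogeneous G₀ 2 ∧
      φ (Polynomial.eval (MvPolynomial.X (⟨1, by omega⟩ : Fin n))
          (Polynomial.hasseDeriv (n - 2) f)) =
        MvPolynomial.C G₂ * MvPolynomial.X (⟨1, by omega⟩ : Fin n) ^ 2 +
          G₁ * MvPolynomial.X (⟨1, by omega⟩ : Fin n) + G₀ ∧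
      G₂ ≠ 0 := by
  obtain ⟨m, rfl⟩ : ∃ m, n = m + 2 := ⟨n - 2, by omega⟩
  have hm : (1 : ℚ) ≤ m := by exact_mod_cast (by omega : 1 ≤ m)
  have hm1 : (m : ℚ) + 1 ≠ 0 := by positivity
  set s : MvPolynomial (Fin (m + 2)) ℚ := ∑ i : Fin m, MvPolynomial.X i.succ.succ with hs
  set p : MvPolynomial (Fin (m + 2)) ℚ := ∑ i : Fin m, MvPolynomial.X i.succ.succ ^ 2 with hp
  set c : ℚ := ((m : ℚ) + 1)⁻¹ with hc
  have hX (i : Fin m) : (MvPolynomial.X i.succ.succ : MvPolynomial (Fin (m + 2)) ℚ) ∈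
      MvPolynomial.supported ℚ {v : Fin (m + 2) | 2 ≤ v.val} :=
    Algebra.subset_adjoin ⟨i.succ.succ, by simp, rfl⟩
  have hsS : s ∈ MvPolynomial.supported ℚ {v : Fin (m + 2) | 2 ≤ v.val} :=
    sum_mem fun i _ => hX i
  have hpS : p ∈ MvPolynomial.supported ℚ {v : Fin (m + 2) | 2 ≤ v.val} :=
    sum_mem fun i _ => pow_mem (hX i) 2
  have hCS (a : ℚ) : (MvPolynomial.C a : MvPolynomial (Fin (m + 2)) ℚ) ∈
      MvPolynomial.supported ℚ {v : Fin (m + 2) | 2 ≤ v.val} :=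
    Subalgebra.algebraMap_mem _ a
  have hsH : s.IsHomogeneous 1 :=
    MvPolynomial.IsHomogeneous.sum _ _ _ fun i _ => MvPolynomial.isHomogeneous_X _ _
  have hpH : p.IsHomogeneous 2 :=
    MvPolynomial.IsHomogeneous.sum _ _ _ fun i _ => by
      simpa using (MvPolynomial.isHomogeneous_X ℚ i.succ.succ).pow 2
  have hsH2 : (s ^ 2).IsHomogeneous 2 := by simpa using hsH.pow 2
  refine ⟨MvPolynomial.C (2 * c - m - 1) * s,
    MvPolynomial.C (c + 1 / 2) * s ^ 2 - MvPolynomial.C (1 / 2) * p,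
    mul_mem (hCS _) hsS, sub_mem (mul_mem (hCS _) (pow_mem hsS 2)) (mul_mem (hCS _) hpS),
    hsH.C_mul _, (hsH2.C_mul _).sub (hpH.C_mul _), ?_, ?_⟩
  · have h1 : (⟨1, by omega⟩ : Fin (m + 2)) = Fin.succ 0 := rfl
    rw [h1]
    set y : MvPolynomial (Fin (m + 2)) ℚ := MvPolynomial.X (Fin.succ 0) with hy
    have hφ0 : φ (MvPolynomial.X 0) = MvPolynomial.C c * (y + s) := by
      rw [hφ, MvPolynomial.aeval_X]
      simp only [Finset.sum_filter, Fin.sum_univ_succ, hc, hy, hs]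
      simp
      left
      ring
    have hφs (i : Fin (m + 1)) : φ (MvPolynomial.X i.succ) = MvPolynomial.X i.succ := by
      rw [hφ, MvPolynomial.aeval_X]
      simp
    have hφS : φ s = s := by
      rw [hs, map_sum]
      exact Finset.sum_congr rfl fun i _ => hφs i.succ
    have hφP : φ p = p := by
      rw [hp, map_sum]
      exact Finset.sum_congr rfl fun i _ => by rw [map_pow, hφs i.succ]
    have hφy : φ y = y := hφs 0
    have key := congrArg φ (two_mul_eval_hasseDeriv_prod_X_sub_C m y)
    rw [← hf] at key
    simp only [Fin.sum_univ_succ, ← hs, ← hp, ← hy, map_add, map_sub, map_mul, map_pow, hφ0, hφS,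
      hφP, hφy, map_natCast, map_ofNat, map_one] at key
    have hcm : MvPolynomial.C c * ((m : MvPolynomial (Fin (m + 2)) ℚ) + 1) = 1 := by
      rw [← map_natCast (MvPolynomial.C (σ := Fin (m + 2)) (R := ℚ)) m, ← map_one MvPolynomial.C,
        ← map_add, ← map_mul, hc, inv_mul_cancel₀ hm1]
    have hG : 2 * MvPolynomial.C (σ := Fin (m + 2)) G₂ =
        (m : MvPolynomial (Fin (m + 2)) ℚ) ^ 2 + (m : MvPolynomial (Fin (m + 2)) ℚ) - 2 + 2 * MvPolynomial.C c  := by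
      have : 2 * G₂ = (m : ℚ) ^ 2 + m - 2 + 2 * c := by
        rw [hG₂, hc]
        push_cast
        rw [show (m : ℚ) + 2 - 1 = m + 1 by ring]
        field_simp
        ring
      simpa only [map_add, map_sub, map_mul, map_pow, map_natCast, map_ofNat] using
        congrArg (MvPolynomial.C (σ := Fin (m + 2))) this
    have hhalf : 2 * MvPolynomial.C (σ := Fin (m + 2)) (1 / 2 : ℚ) = 1 := by
      rw [show (2 : MvPolynomial (Fin (m + 2)) ℚ) = MvPolynomial.C 2 from (map_ofNat _ 2).symm,
        ← MvPolynomial.C_mul, ← MvPolynomial.C_1]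
      norm_num
    refine mul_left_cancel₀ (two_ne_zero (α := MvPolynomial (Fin (m + 2)) ℚ)) ?_
    rw [Nat.add_sub_cancel]
    simp only [map_add, map_sub, map_mul, map_natCast, map_ofNat, map_one]
    linear_combination key - 2 * (y + s) * y * hcm - y ^ 2 * hG - (s ^ 2 - p) * hhalf
  · rw [hG₂]
    push_cast
    refine div_ne_zero (mul_ne_zero ?_ ?_) ?_
    · linarith
    · nlinarith
    · linarith
end

section
/- Let p be an odd prime. In the polynomial ring 𝔽_p[x_1, x_2, x_3], the ideal generated by (x_2 − x_1)(x_2 − x_3), 2x_1 − x_2 − x_3, x_1^p − x_1, x_2^p − x_2, and x_3^p − x_3 is equal to the ideal generated by x_1 − x_2, x_2 − x_3, and x_3^p − x_3. -/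
open MvPolynomial

/-- In characteristic `p`, if `a - b` and `b ^ p - b` lie in an ideal, so does `a ^ p - a`. -/
theorem Ideal.pow_char_sub_self_mem {R : Type*} [CommRing R] {p : ℕ} [Fact p.Prime] [CharP R p]
    {I : Ideal R} {a b : R} (hab : a - b ∈ I) (hb : b ^ p - b ∈ I) : a ^ p - a ∈ I := by
  have h : (a - b) ^ p ∈ I := I.pow_mem_of_mem hab p (Fact.out : p.Prime).pos
  rw [sub_pow_char] at h
  convert I.add_mem (I.sub_mem h hab) hb using 1
  ring

/-- In characteristic `p`, if `a ^ p - a`, `b ^ p - b` and `(a - b) ^ 2` lie in an ideal, so does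
`a - b`. -/
theorem Ideal.sub_mem_of_sq_mem_of_pow_char_sub_self_mem {R : Type*} [CommRing R] {p : ℕ}
    [Fact p.Prime] [CharP R p] {I : Ideal R} {a b : R} (hsq : (a - b) ^ 2 ∈ I)
    (ha : a ^ p - a ∈ I) (hb : b ^ p - b ∈ I) : a - b ∈ I := by
  have h : (a - b) ^ p ∈ I := I.pow_mem_of_pow_mem hsq (Fact.out : p.Prime).two_le
  rw [sub_pow_char] at h
  convert I.sub_mem h (I.sub_mem ha hb) using 1
  ring

/-- The three-variable ideal identity in an arbitrary commutative ring of odd characteristic. -/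
theorem Ideal.span_eq_span_of_odd_char {R : Type*} [CommRing R] {p : ℕ} [Fact p.Prime] [CharP R p]
    (hodd : Odd p) (x y z : R) :
    Ideal.span {(y - x) * (y - z), 2 * x - y - z, x ^ p - x, y ^ p - y, z ^ p - z} =
      Ideal.span {x - y, y - z, z ^ p - z} := by
  apply le_antisymm <;> rw [Ideal.span_le]
  · set J := Ideal.span {x - y, y - z, z ^ p - z}
    have hxy : x - y ∈ J := Ideal.subset_span (by simp)
    have hyz : y - z ∈ J := Ideal.subset_span (by simp)
    have hz : z ^ p - z ∈ J := Ideal.subset_span (by simp)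
    have hy := Ideal.pow_char_sub_self_mem hyz hz
    have hx := Ideal.pow_char_sub_self_mem hxy hy
    have hlin : 2 * x - y - z ∈ J := by
      convert J.add_mem (J.mul_mem_left 2 hxy) hyz using 1
      ring
    rintro _ (rfl | rfl | rfl | rfl | rfl)
    exacts [J.mul_mem_left _ hyz, hlin, hx, hy, hz]
  · set I := Ideal.span {(y - x) * (y - z), 2 * x - y - z, x ^ p - x, y ^ p - y, z ^ p - z}
    have hmul : (y - x) * (y - z) ∈ I := Ideal.subset_span (by simp)
    have hlin : 2 * x - y - z ∈ I := Ideal.subset_span (by simp)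
    have hy : y ^ p - y ∈ I := Ideal.subset_span (by simp)
    have hz : z ^ p - z ∈ I := Ideal.subset_span (by simp)
    have hsq : (y - z) ^ 2 ∈ I := by
      convert I.add_mem (I.mul_mem_left 2 hmul) (I.mul_mem_left (y - z) hlin) using 1
      ring
    have hyz := Ideal.sub_mem_of_sq_mem_of_pow_char_sub_self_mem hsq hy hz
    have hxy : x - y ∈ I := by
      obtain ⟨k, hk⟩ := hodd
      have hp0 : (2 * k + 1 : R) = 0 := by
        exact_mod_cast hk ▸ CharP.cast_eq_zero R p
      convert I.mul_mem_left (-(k : R)) (I.sub_mem hlin hyz) using 1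
      linear_combination (x - y) * hp0
    rintro _ (rfl | rfl | rfl)
    exacts [hxy, hyz, hz]

/-- For an odd prime `p`, in `𝔽_p[x₁, x₂, x₃]` the ideal generated by
`(x₂ - x₁)(x₂ - x₃)`, `2x₁ - x₂ - x₃`, `x₁^p - x₁`, `x₂^p - x₂`, `x₃^p - x₃` equals the
ideal generated by `x₁ - x₂`, `x₂ - x₃`, `x₃^p - x₃`. -/
theorem span_eq_groebner_n_three (p : ℕ) (hp : p.Prime) (hodd : Odd p) :
    Ideal.span {((MvPolynomial.X 1 - MvPolynomial.X 0) *
          (MvPolynomial.X 1 - MvPolynomial.X 2) : MvPolynomial (Fin 3) (ZMod p)),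
        2 * MvPolynomial.X 0 - MvPolynomial.X 1 - MvPolynomial.X 2,
        MvPolynomial.X 0 ^ p - MvPolynomial.X 0,
        MvPolynomial.X 1 ^ p - MvPolynomial.X 1,
        MvPolynomial.X 2 ^ p - MvPolynomial.X 2} =
      Ideal.span {(MvPolynomial.X 0 - MvPolynomial.X 1 : MvPolynomial (Fin 3) (ZMod p)),
        MvPolynomial.X 1 - MvPolynomial.X 2,
        MvPolynomial.X 2 ^ p - MvPolynomial.X 2} := by
  have : Fact p.Prime := ⟨hp⟩
  exact Ideal.span_eq_span_of_odd_char hodd _ _ _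
end
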